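/- Let V be a vector space over ℂ and let G : V × V → ℂ be an alternating (antisymmetric) bilinear form, with CCR ideal I_G ⊆ T(V). Then T(V) is the internal direct sum, as a ℂ-vector space, of the subspace of symmetric elements and the ideal I_G: every x ∈ T(V) admits a unique decomposition x = s + g with s symmetric and g ∈ I_G. In particular, the subspace of symmetric elements intersects I_G only in 0, and there is a unique linear projection S : T(V) → T(V) with range the symmetric elements and kernel I_G. -/

import Mathlib

variable {V : Type*} [AddCommGroup V] [Module ℂ V]

/-- An element of the tensor algebra `T(V) ≅ ⨁ n, V^⊗n` is *symmetric* if each of its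
homogeneous components is fixed by all permutations of the tensor factors. -/
def IsSymmElem (x : TensorAlgebra ℂ V) : Prop :=
  ∀ (n : ℕ) (σ : Equiv.Perm (Fin n)),
    PiTensorProduct.reindex ℂ (fun _ : Fin n => V) σ (TensorAlgebra.toDirectSum x n)
      = TensorAlgebra.toDirectSum x n

/-- The CCR generators `ι v * ι w - ι w * ι v - G(v,w)·1`, `v, w ∈ V`. -/
def ccrSet (G : V →ₗ[ℂ] V →ₗ[ℂ] ℂ) : Set (TensorAlgebra ℂ V) :=
  {x | ∃ v w : V, x = TensorAlgebra.ι ℂ v * TensorAlgebra.ι ℂ w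
    - TensorAlgebra.ι ℂ w * TensorAlgebra.ι ℂ v
    - algebraMap ℂ (TensorAlgebra ℂ V) (G v w)}

open TensorAlgebra

namespace TensorAlgebra

/-- To prove a linear property of all elements of the tensor algebra, it suffices to prove it
for `1` and to show that it is inherited under left multiplication by vectors. -/
theorem induction_ι_mul {C : TensorAlgebra ℂ V → Prop} (one : C 1)
    (add : ∀ x y, C x → C y → C (x + y)) (smul : ∀ (c : ℂ) x, C x → C (c • x))
    (ι_mul : ∀ v x, C x → C (ι ℂ v * x)) (x : TensorAlgebra ℂ V) : C x := by
  suffices h : ∀ y, C y → C (x * y) by simpa using h 1 one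
  induction x using TensorAlgebra.induction with
  | algebraMap r => intro y hy; simpa [Algebra.algebraMap_eq_smul_one] using smul r y hy
  | ι v => exact ι_mul v
  | mul a b ha hb => intro y hy; rw [mul_assoc]; exact ha _ (hb _ hy)
  | add a b ha hb => intro y hy; rw [add_mul]; exact add _ _ (ha _ hy) (hb _ hy)

/-- The algebra morphism `x ↦ x + ε • D x`, where `D` is the derivation of the tensor algebra
extending the linear form `φ`. -/
noncomputable def contractHom (φ : V →ₗ[ℂ] ℂ) :
    TensorAlgebra ℂ V →ₐ[ℂ] TrivSqZeroExt (TensorAlgebra ℂ V) (TensorAlgebra ℂ V) :=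
  TensorAlgebra.lift ℂ
    { toFun := fun v => .inl (ι ℂ v) + .inr (algebraMap ℂ _ (φ v))
      map_add' := fun v w => by ext <;> simp [Algebra.algebraMap_eq_smul_one, add_smul]
      map_smul' := fun c v => by ext <;> simp [Algebra.algebraMap_eq_smul_one, mul_smul] }

theorem fst_contractHom (φ : V →ₗ[ℂ] ℂ) (x : TensorAlgebra ℂ V) :
    (contractHom φ x).fst = x := by
  have h : (TrivSqZeroExt.fstHom ℂ (TensorAlgebra ℂ V) (TensorAlgebra ℂ V)).comp
      (contractHom φ) = AlgHom.id ℂ _ := by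
    ext v
    simp [contractHom]
  exact AlgHom.congr_fun h x

/-- The derivation of the tensor algebra that extends the linear form `φ`. -/
noncomputable def contract (φ : V →ₗ[ℂ] ℂ) : TensorAlgebra ℂ V →ₗ[ℂ] TensorAlgebra ℂ V where
  toFun x := (contractHom φ x).snd
  map_add' x y := by simp
  map_smul' c x := by simp

theorem contract_mul (φ : V →ₗ[ℂ] ℂ) (x y : TensorAlgebra ℂ V) :
    contract φ (x * y) = x * contract φ y + contract φ x * y := by
  simp [contract, fst_contractHom]

@[simp]
theorem contract_ι (φ : V →ₗ[ℂ] ℂ) (v : V) : contract φ (ι ℂ v) = algebraMap ℂ _ (φ v) := by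
  simp [contract, contractHom, Algebra.algebraMap_eq_smul_one]

@[simp]
theorem contract_one (φ : V →ₗ[ℂ] ℂ) : contract φ 1 = 0 := by
  simp [contract]

@[simp]
theorem contract_algebraMap (φ : V →ₗ[ℂ] ℂ) (c : ℂ) : contract φ (algebraMap ℂ _ c) = 0 := by
  simp [Algebra.algebraMap_eq_smul_one]

theorem contract_ι_mul (φ : V →ₗ[ℂ] ℂ) (v : V) (x : TensorAlgebra ℂ V) :
    contract φ (ι ℂ v * x) = ι ℂ v * contract φ x + φ v • x := by
  rw [contract_mul, contract_ι, Algebra.smul_def]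

theorem contract_add (φ ψ : V →ₗ[ℂ] ℂ) : contract (φ + ψ) = contract φ + contract ψ := by
  ext x
  induction x using induction_ι_mul with
  | one => simp
  | add x y hx hy => rw [map_add, hx, hy, map_add]
  | smul c x hx => rw [map_smul, hx, map_smul]
  | ι_mul v x hx =>
    simp only [LinearMap.add_apply, contract_ι_mul] at hx ⊢
    rw [hx, add_smul, mul_add]
    abel

theorem contract_smul (c : ℂ) (φ : V →ₗ[ℂ] ℂ) : contract (c • φ) = c • contract φ := by
  ext x
  induction x using induction_ι_mul with
  | one => simp
  | add x y hx hy => rw [map_add, hx, hy, map_add]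
  | smul c x hx => rw [map_smul, hx, map_smul]
  | ι_mul v x hx =>
    simp only [LinearMap.smul_apply, contract_ι_mul] at hx ⊢
    rw [hx, smul_add, mul_smul_comm, smul_eq_mul, mul_smul]

theorem contract_comm (φ ψ : V →ₗ[ℂ] ℂ) (x : TensorAlgebra ℂ V) :
    contract φ (contract ψ x) = contract ψ (contract φ x) := by
  induction x using induction_ι_mul with
  | one => simp
  | add x y hx hy => simp only [map_add, hx, hy]
  | smul c x hx => simp only [map_smul, hx]
  | ι_mul v x hx =>
    simp only [map_add, map_smul, contract_ι_mul, hx]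
    abel

theorem contract_ι_pow (φ : V →ₗ[ℂ] ℂ) {v : V} (hv : φ v = 0) (n : ℕ) :
    contract φ (ι ℂ v ^ n) = 0 := by
  induction n with
  | zero => simp
  | succ n ih => rw [pow_succ', contract_ι_mul, ih, hv]; simp

/-- The operator `x ↦ v x + ½ D x` on the tensor algebra, where `D` is the derivation that
extends `H v`. -/
noncomputable def ccrOp (H : V →ₗ[ℂ] V →ₗ[ℂ] ℂ) : V →ₗ[ℂ] Module.End ℂ (TensorAlgebra ℂ V) where
  toFun v := LinearMap.mulLeft ℂ (ι ℂ v) + (2⁻¹ : ℂ) • contract (H v)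
  map_add' v w := by
    ext x
    simp only [map_add, contract_add, LinearMap.add_apply, LinearMap.smul_apply,
      LinearMap.mulLeft_apply, smul_add, add_mul]
    abel
  map_smul' c v := by
    ext x
    simp only [map_smul, contract_smul, LinearMap.add_apply, LinearMap.smul_apply,
      LinearMap.mulLeft_apply, smul_add, smul_mul_assoc, RingHom.id_apply]
    rw [smul_comm c]

/-- The linear endomorphism of the tensor algebra obtained by letting it act on `1` through the
operators `ccrOp H v`. -/
noncomputable def ccrTwist (H : V →ₗ[ℂ] V →ₗ[ℂ] ℂ) : TensorAlgebra ℂ V →ₗ[ℂ] TensorAlgebra ℂ V :=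
  LinearMap.applyₗ (1 : TensorAlgebra ℂ V) ∘ₗ (TensorAlgebra.lift ℂ (ccrOp H)).toLinearMap

theorem ccrTwist_mul (H : V →ₗ[ℂ] V →ₗ[ℂ] ℂ) (x y : TensorAlgebra ℂ V) :
    ccrTwist H (x * y) = TensorAlgebra.lift ℂ (ccrOp H) x (ccrTwist H y) := by
  simp [ccrTwist]

@[simp]
theorem ccrTwist_one (H : V →ₗ[ℂ] V →ₗ[ℂ] ℂ) : ccrTwist H 1 = 1 := by
  simp [ccrTwist]

theorem ccrTwist_ι_mul (H : V →ₗ[ℂ] V →ₗ[ℂ] ℂ) (v : V) (x : TensorAlgebra ℂ V) :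
    ccrTwist H (ι ℂ v * x) =
      ι ℂ v * ccrTwist H x + (2⁻¹ : ℂ) • contract (H v) (ccrTwist H x) := by
  rw [ccrTwist_mul]
  simp [ccrOp]

theorem ccrTwist_ι_pow {H : V →ₗ[ℂ] V →ₗ[ℂ] ℂ} (hH : H.IsAlt) (v : V) (n : ℕ) :
    ccrTwist H (ι ℂ v ^ n) = ι ℂ v ^ n := by
  induction n with
  | zero => simp
  | succ n ih => rw [pow_succ', ccrTwist_ι_mul, ih, contract_ι_pow _ (hH v)]; simp

theorem contract_ccrTwist (H : V →ₗ[ℂ] V →ₗ[ℂ] ℂ) (φ : V →ₗ[ℂ] ℂ) (x : TensorAlgebra ℂ V) :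
    contract φ (ccrTwist H x) = ccrTwist H (contract φ x) := by
  induction x using induction_ι_mul with
  | one => simp
  | add x y hx hy => simp only [map_add, hx, hy]
  | smul c x hx => simp only [map_smul, hx]
  | ι_mul v x hx =>
    simp only [map_add, map_smul, contract_ι_mul, ccrTwist_ι_mul, contract_comm φ, hx]
    abel

theorem ccrTwist_neg_ccrTwist (H : V →ₗ[ℂ] V →ₗ[ℂ] ℂ) (x : TensorAlgebra ℂ V) :
    ccrTwist (-H) (ccrTwist H x) = x := by
  induction x using induction_ι_mul with
  | one => simp
  | add x y hx hy => simp only [map_add, hx, hy]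
  | smul c x hx => simp only [map_smul, hx]
  | ι_mul v x hx =>
    have hneg : contract (-(H v)) = -contract (H v) := by
      rw [← neg_one_smul ℂ, contract_smul]
      module
    simp only [map_add, map_smul, ccrTwist_ι_mul, ← contract_ccrTwist, hx, LinearMap.neg_apply,
      hneg, smul_neg, neg_add_cancel_right]

theorem smul_mem_twoSidedIdeal {I : TwoSidedIdeal (TensorAlgebra ℂ V)} (c : ℂ)
    {x : TensorAlgebra ℂ V} (hx : x ∈ I) : c • x ∈ I := by
  rw [Algebra.smul_def]
  exact I.mul_mem_left _ _ hx

theorem contract_mem_span_ccrSet (G : V →ₗ[ℂ] V →ₗ[ℂ] ℂ) (φ : V →ₗ[ℂ] ℂ) {x : TensorAlgebra ℂ V}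
    (hx : x ∈ TwoSidedIdeal.span (ccrSet G)) : contract φ x ∈ TwoSidedIdeal.span (ccrSet G) := by
  induction hx using TwoSidedIdeal.span_induction with
  | mem x h =>
    obtain ⟨v, w, rfl⟩ := h
    have h0 : contract φ (ι ℂ v * ι ℂ w - ι ℂ w * ι ℂ v - algebraMap ℂ _ (G v w)) = 0 := by
      simp only [map_sub, contract_mul, contract_ι, contract_algebraMap, sub_zero]
      rw [Algebra.commutes (φ v), Algebra.commutes (φ w)]
      abel
    rw [h0]
    exact TwoSidedIdeal.zero_mem _
  | zero => rw [map_zero]; exact TwoSidedIdeal.zero_mem _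
  | add x y _ _ hx hy => rw [map_add]; exact TwoSidedIdeal.add_mem _ hx hy
  | neg x _ hx => rw [map_neg]; exact TwoSidedIdeal.neg_mem _ hx
  | left_absorb a x h hx =>
    rw [contract_mul]
    exact TwoSidedIdeal.add_mem _ (TwoSidedIdeal.mul_mem_left _ _ _ hx)
      (TwoSidedIdeal.mul_mem_left _ _ _ h)
  | right_absorb b x h hx =>
    rw [contract_mul]
    exact TwoSidedIdeal.add_mem _ (TwoSidedIdeal.mul_mem_right _ _ _ h)
      (TwoSidedIdeal.mul_mem_right _ _ _ hx)

theorem lift_ccrOp_mem_span_ccrSet (G H : V →ₗ[ℂ] V →ₗ[ℂ] ℂ) (a : TensorAlgebra ℂ V)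
    {x : TensorAlgebra ℂ V} (hx : x ∈ TwoSidedIdeal.span (ccrSet G)) :
    TensorAlgebra.lift ℂ (ccrOp H) a x ∈ TwoSidedIdeal.span (ccrSet G) := by
  induction a using TensorAlgebra.induction generalizing x with
  | algebraMap r => simpa using! smul_mem_twoSidedIdeal r hx
  | ι v =>
    rw [lift_ι_apply]
    exact TwoSidedIdeal.add_mem _ (TwoSidedIdeal.mul_mem_left _ _ _ hx)
      (smul_mem_twoSidedIdeal _ (contract_mem_span_ccrSet G _ hx))
  | mul a b ha hb => rw [map_mul]; exact ha (hb hx)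
  | add a b ha hb => rw [map_add]; exact TwoSidedIdeal.add_mem _ (ha hx) (hb hx)

theorem ccrTwist_mem_span_ccrSet (G : V →ₗ[ℂ] V →ₗ[ℂ] ℂ) {H : V →ₗ[ℂ] V →ₗ[ℂ] ℂ} (hH : H.IsAlt)
    {x : TensorAlgebra ℂ V} (hx : x ∈ TwoSidedIdeal.span (ccrSet G)) :
    ccrTwist H x ∈ TwoSidedIdeal.span (ccrSet (G - H)) := by
  rw [TwoSidedIdeal.mem_span_iff_mem_addSubgroup_closure] at hx
  induction hx using AddSubgroup.closure_induction with
  | zero => rw [map_zero]; exact TwoSidedIdeal.zero_mem _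
  | add x y _ _ hx hy => rw [map_add]; exact TwoSidedIdeal.add_mem _ hx hy
  | neg x _ hx => rw [map_neg]; exact TwoSidedIdeal.neg_mem _ hx
  | mem x hx =>
    obtain ⟨_, ⟨a, -, _, ⟨v, w, rfl⟩, rfl⟩, b, -, rfl⟩ := hx
    simp only [mul_assoc, ccrTwist_mul H a]
    apply lift_ccrOp_mem_span_ccrSet
    have key : ccrTwist H ((ι ℂ v * ι ℂ w - ι ℂ w * ι ℂ v - algebraMap ℂ _ (G v w)) * b) =
        (ι ℂ v * ι ℂ w - ι ℂ w * ι ℂ v - algebraMap ℂ _ ((G - H) v w)) * ccrTwist H b := by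
      have hwv : H w v = -H v w := (hH.neg v w).symm
      simp only [sub_mul, mul_assoc, map_sub, ccrTwist_ι_mul, map_add, map_smul, contract_ι_mul,
        ← Algebra.smul_def, contract_comm (H w), hwv, LinearMap.sub_apply, mul_add,
        mul_smul_comm]
      module
    rw [key]
    exact TwoSidedIdeal.mul_mem_right _ _ _ (TwoSidedIdeal.subset_span ⟨v, w, rfl⟩)

end TensorAlgebra

open scoped Nat

namespace MultilinearMap

/-- **Polarization**: the symmetrization of a multilinear map is an alternating sum of its values
on the diagonal. -/
theorem sum_perm_eq_sum_diagonal {R M N ι : Type*} [CommRing R] [AddCommGroup M] [Module R M]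
    [AddCommGroup N] [Module R N] [Fintype ι] [DecidableEq ι]
    (f : MultilinearMap R (fun _ : ι => M) N) (v : ι → M) :
    ∑ σ : Equiv.Perm ι, f (v ∘ σ) =
      ∑ s : Finset ι, (-1 : ℤ) ^ sᶜ.card • f fun _ => ∑ i ∈ s, v i := by
  have hcoef (r : ι → ι) :
      ∑ s : Finset ι, (if ∀ i, r i ∈ s then (-1 : ℤ) ^ sᶜ.card else 0) =
        if Function.Bijective r then 1 else 0 := by
    have hcompl : ∑ s : Finset ι, (if ∀ i, r i ∈ s then (-1 : ℤ) ^ sᶜ.card else 0) =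
        ∑ t ∈ (Finset.univ.image r)ᶜ.powerset, (-1 : ℤ) ^ t.card := by
      rw [← Finset.sum_filter]
      refine Finset.sum_nbij' compl compl ?_ ?_ ?_ ?_ ?_
      · intro s hs
        simp only [Finset.mem_filter, Finset.mem_univ, true_and, Finset.mem_powerset] at hs ⊢
        rw [Finset.compl_subset_compl]
        simpa [Finset.subset_iff] using hs
      · intro t ht
        simp only [Finset.mem_filter, Finset.mem_univ, true_and, Finset.mem_powerset] at ht ⊢
        intro i
        rw [Finset.mem_compl]
        intro hi
        simpa using ht hi
      all_goals simp
    rw [hcompl, Finset.sum_powerset_neg_one_pow_card]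
    refine if_congr ?_ rfl rfl
    rw [← Finite.surjective_iff_bijective, Finset.compl_eq_empty_iff, Finset.eq_univ_iff_forall]
    simp [Function.Surjective]
  calc ∑ σ : Equiv.Perm ι, f (v ∘ σ)
      = ∑ r : ι → ι, (if Function.Bijective r then (1 : ℤ) else 0) • f (v ∘ r) := by
        simp only [ite_smul, one_smul, zero_smul]
        rw [← Finset.sum_filter]
        refine Finset.sum_bij (fun σ _ => ⇑σ) ?_ ?_ ?_ ?_
        · intro σ _
          simp
        · intro σ _ τ _ h
          exact DFunLike.coe_injective h
        · intro r hr
          exact ⟨Equiv.ofBijective r (by simpa using hr), Finset.mem_univ _, rfl⟩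
        · intros
          rfl
    _ = ∑ s : Finset ι, ∑ r : ι → ι,
          (if ∀ i, r i ∈ s then (-1 : ℤ) ^ sᶜ.card else 0) • f (v ∘ r) := by
        rw [Finset.sum_comm]
        simp only [← Finset.sum_smul, hcoef]
    _ = _ := by
        refine Finset.sum_congr rfl fun s _ => ?_
        rw [f.map_sum_finset (fun _ i => v i) fun _ => s, Finset.smul_sum]
        simp only [ite_smul, zero_smul]
        rw [← Finset.sum_filter]
        refine Finset.sum_congr ?_ fun _ _ => rfl
        ext r
        simp

end MultilinearMap

/-- Lists that are permutations of each other enumerate the same tuple up to a permutation of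
the indices. -/
theorem List.Perm.exists_ofFn_comp_perm {α : Type*} {l₁ l₂ : List α} (h : l₁.Perm l₂) :
    ∃ σ : Equiv.Perm (Fin l₂.length), l₁ = List.ofFn (l₂.get ∘ σ) := by
  classical
  have hinj : Function.Injective (h.idxBij ∘ Fin.cast h.length_eq.symm) :=
    h.idxBij_injective.comp (Fin.cast_injective _)
  refine ⟨Equiv.ofBijective _ (Finite.injective_iff_bijective.mp hinj), ?_⟩
  refine List.ext_getElem (by simp [h.length_eq]) fun i h₁ h₂ => ?_
  simp

namespace TensorAlgebra

open scoped TensorProduct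

/-- The product in the tensor algebra of a list of vectors. -/
noncomputable def word (l : List V) : TensorAlgebra ℂ V := (l.map (ι ℂ)).prod

theorem word_ofFn {n : ℕ} (v : Fin n → V) : word (List.ofFn v) = tprod ℂ V n v := by
  simp [word, List.map_ofFn, Function.comp_def]

/-- To prove a linear property of all elements of the tensor algebra, it suffices to prove it
for words. -/
theorem induction_word {C : TensorAlgebra ℂ V → Prop} (word : ∀ l, C (word l))
    (add : ∀ x y, C x → C y → C (x + y)) (smul : ∀ (c : ℂ) x, C x → C (c • x))
    (x : TensorAlgebra ℂ V) : C x := by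
  suffices h : ∀ l, C (TensorAlgebra.word l * x) by simpa [TensorAlgebra.word] using h []
  induction x using induction_ι_mul with
  | one => simpa using word
  | add x y hx hy => intro l; rw [mul_add]; exact add _ _ (hx l) (hy l)
  | smul c x hx => intro l; rw [mul_smul_comm]; exact smul _ _ (hx l)
  | ι_mul v x hx => intro l; simpa [TensorAlgebra.word, mul_assoc] using hx (l ++ [v])

/-- The average over all permutations of the tensor factors. -/
noncomputable def powerSymmetrizer (n : ℕ) : (⨂[ℂ]^n V) →ₗ[ℂ] ⨂[ℂ]^n V :=
  (n ! : ℂ)⁻¹ • ∑ σ : Equiv.Perm (Fin n),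
    (PiTensorProduct.reindex ℂ (fun _ : Fin n => V) σ).toLinearMap

theorem powerSymmetrizer_tprod {n : ℕ} (v : Fin n → V) :
    powerSymmetrizer n (PiTensorProduct.tprod ℂ v) =
      (n ! : ℂ)⁻¹ • ∑ σ : Equiv.Perm (Fin n), PiTensorProduct.tprod ℂ (v ∘ σ) := by
  simp only [powerSymmetrizer, LinearMap.smul_apply, LinearMap.sum_apply, LinearEquiv.coe_coe]
  congr 1
  refine Fintype.sum_equiv (Equiv.inv (Equiv.Perm (Fin n))) _ _ fun σ => ?_
  exact PiTensorProduct.reindex_tprod σ v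

theorem reindex_powerSymmetrizer {n : ℕ} (τ : Equiv.Perm (Fin n)) (x : ⨂[ℂ]^n V) :
    PiTensorProduct.reindex ℂ (fun _ : Fin n => V) τ (powerSymmetrizer n x) =
      powerSymmetrizer n x := by
  suffices h : (PiTensorProduct.reindex ℂ (fun _ : Fin n => V) τ).toLinearMap ∘ₗ
      powerSymmetrizer n = powerSymmetrizer n from LinearMap.congr_fun h x
  refine PiTensorProduct.ext (MultilinearMap.ext fun v => ?_)
  simp only [LinearMap.compMultilinearMap_apply, LinearMap.comp_apply, powerSymmetrizer_tprod,
    LinearEquiv.coe_coe, map_smul, map_sum]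
  congr 1
  refine Fintype.sum_equiv (Equiv.mulRight τ⁻¹) _ _ fun σ => ?_
  exact PiTensorProduct.reindex_tprod τ _

theorem powerSymmetrizer_of_forall_reindex {n : ℕ} {x : ⨂[ℂ]^n V}
    (hx : ∀ σ, PiTensorProduct.reindex ℂ (fun _ : Fin n => V) σ x = x) :
    powerSymmetrizer n x = x := by
  simp only [powerSymmetrizer, LinearMap.smul_apply, LinearMap.sum_apply, LinearEquiv.coe_coe, hx,
    Finset.sum_const, Finset.card_univ, Fintype.card_perm, Fintype.card_fin]
  rw [← Nat.cast_smul_eq_nsmul ℂ, smul_smul, inv_mul_cancel₀ (by exact_mod_cast n.factorial_ne_zero),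
    one_smul]

/-- The degreewise average over all permutations of the tensor factors. -/
noncomputable def symmetrizer : TensorAlgebra ℂ V →ₗ[ℂ] TensorAlgebra ℂ V :=
  ofDirectSum.toLinearMap ∘ₗ DirectSum.lmap powerSymmetrizer ∘ₗ toDirectSum.toLinearMap

theorem toDirectSum_symmetrizer (x : TensorAlgebra ℂ V) (n : ℕ) :
    toDirectSum (symmetrizer x) n = powerSymmetrizer n (toDirectSum x n) := by
  simp [symmetrizer]

theorem isSymmElem_symmetrizer (x : TensorAlgebra ℂ V) : IsSymmElem (symmetrizer x) := by
  intro n σ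
  rw [toDirectSum_symmetrizer, reindex_powerSymmetrizer]

theorem _root_.IsSymmElem.symmetrizer_eq {x : TensorAlgebra ℂ V} (hx : IsSymmElem x) :
    symmetrizer x = x := by
  apply equivDirectSum.injective
  ext n
  exact (toDirectSum_symmetrizer x n).trans (powerSymmetrizer_of_forall_reindex (hx n))

theorem symmetrizer_tprod {n : ℕ} (v : Fin n → V) :
    symmetrizer (tprod ℂ V n v) =
      (n ! : ℂ)⁻¹ • ∑ σ : Equiv.Perm (Fin n), tprod ℂ V n (v ∘ σ) := by
  simp only [symmetrizer, LinearMap.comp_apply, AlgHom.toLinearMap_apply,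
    toDirectSum_tensorPower_tprod, DirectSum.lmap_of, powerSymmetrizer_tprod]
  rw [← DirectSum.lof_eq_of ℂ, map_smul, map_sum, map_smul, map_sum]
  simp only [DirectSum.lof_eq_of, ofDirectSum_of_tprod]

theorem symmetrizer_word_of_perm {l₁ l₂ : List V} (h : l₁.Perm l₂) :
    symmetrizer (word l₁) = symmetrizer (word l₂) := by
  obtain ⟨τ, rfl⟩ := h.exists_ofFn_comp_perm
  conv_rhs => rw [← List.ofFn_get l₂]
  simp only [word_ofFn, symmetrizer_tprod]
  congr 1
  exact Fintype.sum_equiv (Equiv.mulLeft τ) _ _ fun σ => rfl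

theorem symmetrizer_eq_zero_of_mem {x : TensorAlgebra ℂ V}
    (hx : x ∈ TwoSidedIdeal.span (ccrSet (0 : V →ₗ[ℂ] V →ₗ[ℂ] ℂ))) : symmetrizer x = 0 := by
  rw [TwoSidedIdeal.mem_span_iff_mem_addSubgroup_closure] at hx
  induction hx using AddSubgroup.closure_induction with
  | zero => exact map_zero _
  | add x y _ _ hx hy => rw [map_add, hx, hy, add_zero]
  | neg x _ hx => rw [map_neg, hx, neg_zero]
  | mem x hx =>
    obtain ⟨_, ⟨a, -, _, ⟨v, w, rfl⟩, rfl⟩, b, -, rfl⟩ := hx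
    simp only [LinearMap.zero_apply, map_zero, sub_zero]
    induction a using induction_word with
    | add x y hx hy => rw [add_mul, add_mul, map_add, hx, hy, add_zero]
    | smul c x hx => rw [smul_mul_assoc, smul_mul_assoc, map_smul, hx, smul_zero]
    | word l =>
      induction b using induction_word with
      | add x y hx hy => rw [mul_add, map_add, hx, hy, add_zero]
      | smul c x hx => rw [mul_smul_comm, map_smul, hx, smul_zero]
      | word m =>
        have h := symmetrizer_word_of_perm ((List.Perm.swap w v m).append_left l)
        rw [← sub_eq_zero, ← map_sub] at h
        rw [← h]
        congr 1
        simp only [word, List.map_append, List.map_cons, List.prod_append, List.prod_cons]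
        noncomm_ring

theorem word_sub_word_mem {l₁ l₂ : List V} (h : l₁.Perm l₂) :
    word l₁ - word l₂ ∈ TwoSidedIdeal.span (ccrSet (0 : V →ₗ[ℂ] V →ₗ[ℂ] ℂ)) := by
  set I := TwoSidedIdeal.span (ccrSet (0 : V →ₗ[ℂ] V →ₗ[ℂ] ℂ))
  have hcomm (v w : V) : Commute (I.ringCon.mk' (ι ℂ v)) (I.ringCon.mk' (ι ℂ w)) := by
    rw [commute_iff_eq, ← map_mul I.ringCon.mk', ← map_mul I.ringCon.mk']
    refine (RingCon.eq _).mpr ((I.rel_iff _ _).mpr (TwoSidedIdeal.subset_span ⟨v, w, ?_⟩))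
    simp
  rw [← I.rel_iff]
  refine (RingCon.eq _).mp ?_
  change I.ringCon.mk' (word l₁) = I.ringCon.mk' (word l₂)
  rw [word, word, map_list_prod, map_list_prod, List.map_map, List.map_map]
  refine (h.map _).prod_eq' (List.pairwise_map.mpr ?_)
  exact List.pairwise_of_forall fun v w => hcomm v w

theorem sub_symmetrizer_mem (x : TensorAlgebra ℂ V) :
    x - symmetrizer x ∈ TwoSidedIdeal.span (ccrSet (0 : V →ₗ[ℂ] V →ₗ[ℂ] ℂ)) := by
  induction x using induction_word with
  | add x y hx hy => rw [map_add, add_sub_add_comm]; exact TwoSidedIdeal.add_mem _ hx hy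
  | smul c x hx => rw [map_smul, ← smul_sub]; exact smul_mem_twoSidedIdeal c hx
  | word l =>
    obtain ⟨n, v, rfl⟩ : ∃ n, ∃ v : Fin n → V, l = List.ofFn v := ⟨_, _, (List.ofFn_get l).symm⟩
    have hsum : word (List.ofFn v) - symmetrizer (word (List.ofFn v)) =
        (n ! : ℂ)⁻¹ • ∑ σ : Equiv.Perm (Fin n),
          (word (List.ofFn v) - word (List.ofFn (v ∘ σ))) := by
      simp only [word_ofFn, symmetrizer_tprod, Finset.sum_sub_distrib, smul_sub, Finset.sum_const,
        Finset.card_univ, Fintype.card_perm, Fintype.card_fin]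
      rw [← Nat.cast_smul_eq_nsmul ℂ, smul_smul,
        inv_mul_cancel₀ (by exact_mod_cast n.factorial_ne_zero), one_smul]
    rw [hsum]
    exact smul_mem_twoSidedIdeal _ (sum_mem fun σ _ => word_sub_word_mem (σ.ofFn_comp_perm v).symm)

theorem ccrTwist_symmetrizer {H : V →ₗ[ℂ] V →ₗ[ℂ] ℂ} (hH : H.IsAlt) (x : TensorAlgebra ℂ V) :
    ccrTwist H (symmetrizer x) = symmetrizer x := by
  induction x using induction_word with
  | add x y hx hy => simp only [map_add, hx, hy]
  | smul c x hx => simp only [map_smul, hx]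
  | word l =>
    rw [← List.ofFn_get l, word_ofFn, symmetrizer_tprod, MultilinearMap.sum_perm_eq_sum_diagonal]
    simp only [map_smul, map_sum, map_zsmul, tprod_apply, List.ofFn_const, List.prod_replicate]
    simp only [← map_sum, ccrTwist_ι_pow hH]

theorem _root_.IsSymmElem.ccrTwist_eq {H : V →ₗ[ℂ] V →ₗ[ℂ] ℂ} (hH : H.IsAlt)
    {x : TensorAlgebra ℂ V} (hx : IsSymmElem x) : ccrTwist H x = x := by
  rw [← hx.symmetrizer_eq, ccrTwist_symmetrizer hH]

/-- The projection onto the symmetric elements along the CCR ideal of `G`. -/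
noncomputable def ccrSymmetrizer (G : V →ₗ[ℂ] V →ₗ[ℂ] ℂ) :
    TensorAlgebra ℂ V →ₗ[ℂ] TensorAlgebra ℂ V :=
  symmetrizer ∘ₗ ccrTwist G

theorem isSymmElem_ccrSymmetrizer (G : V →ₗ[ℂ] V →ₗ[ℂ] ℂ) (x : TensorAlgebra ℂ V) :
    IsSymmElem (ccrSymmetrizer G x) :=
  isSymmElem_symmetrizer _

theorem _root_.IsSymmElem.ccrSymmetrizer_eq {G : V →ₗ[ℂ] V →ₗ[ℂ] ℂ} (hG : G.IsAlt)
    {x : TensorAlgebra ℂ V} (hx : IsSymmElem x) : ccrSymmetrizer G x = x := by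
  rw [ccrSymmetrizer, LinearMap.comp_apply, hx.ccrTwist_eq hG, hx.symmetrizer_eq]

theorem ccrSymmetrizer_eq_zero_of_mem {G : V →ₗ[ℂ] V →ₗ[ℂ] ℂ} (hG : G.IsAlt)
    {x : TensorAlgebra ℂ V} (hx : x ∈ TwoSidedIdeal.span (ccrSet G)) : ccrSymmetrizer G x = 0 :=
  symmetrizer_eq_zero_of_mem (by simpa using ccrTwist_mem_span_ccrSet G hG hx)

theorem sub_ccrSymmetrizer_mem {G : V →ₗ[ℂ] V →ₗ[ℂ] ℂ} (hG : G.IsAlt) (x : TensorAlgebra ℂ V) :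
    x - ccrSymmetrizer G x ∈ TwoSidedIdeal.span (ccrSet G) := by
  have hneg : (-G).IsAlt := fun v => by simp [hG v]
  have h := ccrTwist_mem_span_ccrSet 0 hneg (sub_symmetrizer_mem (ccrTwist G x))
  rwa [map_sub, ccrTwist_neg_ccrTwist, ccrTwist_symmetrizer hneg, zero_sub, neg_neg] at h

end TensorAlgebra

/-- **Symmetrization lemma.**
For an alternating (antisymmetric) bilinear form `G` on a complex vector space `V`, with
CCR ideal `I_G ⊆ T(V)`: every `x ∈ T(V)` admits a unique decomposition `x = s + g` with
`s` symmetric and `g ∈ I_G`; the symmetric elements intersect `I_G` only in `0`; and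
there is a unique linear projection `S : T(V) → T(V)` with range the symmetric elements
and kernel `I_G`. -/
theorem symmetrization_of_ccr_ideal (G : V →ₗ[ℂ] V →ₗ[ℂ] ℂ)
    (hG : ∀ v : V, G v v = 0) :
    (∀ x : TensorAlgebra ℂ V,
      ∃! p : TensorAlgebra ℂ V × TensorAlgebra ℂ V,
        IsSymmElem p.1 ∧ p.2 ∈ TwoSidedIdeal.span (ccrSet G) ∧ x = p.1 + p.2) ∧
    (∀ x : TensorAlgebra ℂ V,
      IsSymmElem x → x ∈ TwoSidedIdeal.span (ccrSet G) → x = 0) ∧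
    (∃! S : TensorAlgebra ℂ V →ₗ[ℂ] TensorAlgebra ℂ V,
      S.comp S = S ∧ Set.range S = {x | IsSymmElem x} ∧
        ∀ x : TensorAlgebra ℂ V, S x = 0 ↔ x ∈ TwoSidedIdeal.span (ccrSet G)) := by
  have hsymm := fun x => isSymmElem_ccrSymmetrizer G x
  have hfix := fun x (hx : IsSymmElem x) => hx.ccrSymmetrizer_eq hG
  have hzero := fun x hx => ccrSymmetrizer_eq_zero_of_mem (x := x) hG hx
  have hsub := sub_ccrSymmetrizer_mem hG
  refine ⟨fun x => ⟨(ccrSymmetrizer G x, x - ccrSymmetrizer G x), ⟨hsymm x, hsub x, by simp⟩, ?_⟩,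
    fun x hs hx => (hfix x hs).symm.trans (hzero x hx),
    ccrSymmetrizer G, ⟨LinearMap.ext fun x => hfix _ (hsymm x), ?_, ?_⟩, ?_⟩
  · rintro ⟨s, g⟩ ⟨hs, hg, rfl⟩
    simp only at hs hg ⊢
    rw [map_add, hfix s hs, hzero g hg, add_zero, add_sub_cancel_left]
  · ext x
    exact ⟨by rintro ⟨y, rfl⟩; exact hsymm y, fun hx => ⟨x, hfix x hx⟩⟩
  · exact fun x => ⟨fun hx => by simpa [hx] using hsub x, hzero x⟩
  · rintro S ⟨hidem, hrange, hker⟩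
    ext x
    obtain ⟨y, hy⟩ : ccrSymmetrizer G x ∈ Set.range S := hrange ▸ hsymm x
    have hSx : S x - S (ccrSymmetrizer G x) = 0 := by rw [← map_sub]; exact (hker _).mpr (hsub x)
    rw [sub_eq_zero.mp hSx, ← hy]
    exact LinearMap.congr_fun hidem y
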